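/- For every odd integer m ≥ 3, (m+2) · ζ(m+1, 1) = −(π²/2) · ζ(m) + ((m+1)(m+2)/2) · ζ(m+2) − ∑_{i,k ≥ 1, i+2k = m} (i+1) · ζ(i+2) · ζ(2k) − ∑_{i,j,k ≥ 1, i+j+2k = m} ζ(i+1) · ζ(j+1) · ζ(2k). -/

import Mathlib

open scoped BigOperators

/-- Multiple zeta value `ζ(k_1,…,k_r) = ∑_{m_1 > ⋯ > m_r > 0} 1/(m_1^{k_1} ⋯ m_r^{k_r})`;
for a single argument this is the Riemann zeta value. -/
noncomputable def mzv (ks : List ℕ) : ℝ :=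
  ∑' m : Fin ks.length → ℕ,
    if (∀ i, 0 < m i) ∧ (∀ i j, i < j → m j < m i) then
      1 / ∏ i, (m i : ℝ) ^ ks.get i
    else 0

open Filter Topology

/-- The term of index `(i, j)` of `ζ(a, b)`, with summation variables `i + j + 2 > i + 1`. -/
noncomputable def doubleZetaTerm (a b : ℕ) (p : ℕ × ℕ) : ℝ :=
  1 / (((p.1 : ℝ) + p.2 + 2) ^ a * ((p.1 : ℝ) + 1) ^ b)

lemma doubleZetaTerm_nonneg (a b : ℕ) (p : ℕ × ℕ) : 0 ≤ doubleZetaTerm a b p := by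
  unfold doubleZetaTerm; positivity

lemma mzv_singleton (k : ℕ) : mzv [k] = ∑' n : ℕ, 1 / ((n : ℝ) + 1) ^ k := by
  have hinj : Function.Injective (fun (n : ℕ) (_ : Fin [k].length) => n + 1) := by
    intro a b h
    simpa using congrFun h ⟨0, by simp⟩
  unfold mzv
  rw [← hinj.tsum_eq]
  · refine tsum_congr fun n => ?_
    rw [if_pos]
    · simp
    · refine ⟨fun _ => Nat.succ_pos n, fun i j hij => ?_⟩
      have hi := i.2
      have hj := j.2
      simp only [List.length_cons, List.length_nil] at hi hj
      rw [Fin.lt_def] at hij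
      omega
  · intro f hf
    have h : ∀ i, 0 < f i := by
      by_contra hc
      exact hf (if_neg fun h => hc h.1)
    refine ⟨f ⟨0, by simp⟩ - 1, ?_⟩
    funext i
    have hi : i = ⟨0, by simp⟩ := by
      ext
      have := i.2
      simp only [List.length_cons, List.length_nil] at this
      simp only
      omega
    subst hi
    have := h ⟨0, by simp⟩
    simp only
    omega

lemma mzv_pair (a b : ℕ) : mzv [a, b] = ∑' p : ℕ × ℕ, doubleZetaTerm a b p := by
  have hinj : @Function.Injective (ℕ × ℕ) (Fin [a, b].length → ℕ)
      fun p => ![p.1 + p.2 + 2, p.1 + 1] := by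
    rintro ⟨i, j⟩ ⟨i', j'⟩ h
    have h0 : i + j + 2 = i' + j' + 2 := congrFun h (0 : Fin 2)
    have h1 : i + 1 = i' + 1 := congrFun h (1 : Fin 2)
    ext <;> simp only <;> omega
  unfold mzv
  rw [← hinj.tsum_eq]
  · refine tsum_congr fun p => ?_
    rw [if_pos]
    · change 1 / ∏ i : Fin 2, _ = _
      rw [Fin.prod_univ_two]
      simp [doubleZetaTerm]
    · constructor
      · intro (i : Fin 2)
        fin_cases i <;> simp
      · intro (i : Fin 2) (j : Fin 2) hij
        fin_cases i <;> fin_cases j <;> simp_all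
  · intro f hf
    have h : (∀ i, 0 < f i) ∧ ∀ i j, i < j → f j < f i := by
      by_contra hc
      exact hf (if_neg hc)
    have h1 : 0 < f (1 : Fin 2) := h.1 _
    have h2 : f (1 : Fin 2) < f (0 : Fin 2) := h.2 (0 : Fin 2) (1 : Fin 2) Fin.zero_lt_one
    refine ⟨(f (1 : Fin 2) - 1, f (0 : Fin 2) - f (1 : Fin 2) - 1), ?_⟩
    funext (i : Fin 2)
    fin_cases i
    · change f (1 : Fin 2) - 1 + (f (0 : Fin 2) - f (1 : Fin 2) - 1) + 2 = f (0 : Fin 2)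
      omega
    · change f (1 : Fin 2) - 1 + 1 = f (1 : Fin 2)
      omega

lemma hasSum_mzv_singleton {k : ℕ} (hk : 2 ≤ k) :
    HasSum (fun n : ℕ => 1 / ((n : ℝ) + 1) ^ k) (mzv [k]) := by
  rw [mzv_singleton]
  refine Summable.hasSum ?_
  have := (summable_nat_add_iff 1).2 (Real.summable_one_div_nat_pow.2 hk)
  simpa using this

lemma summable_doubleZetaTerm {a b : ℕ} (ha : 2 ≤ a) (hb : 1 ≤ b) :
    Summable (doubleZetaTerm a b) := by
  have hs : Summable fun n : ℕ => 1 / ((n : ℝ) + 1) ^ (3 / 2 : ℝ) := by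
    have := (summable_nat_add_iff 1).2
      (Real.summable_one_div_nat_rpow.2 (by norm_num : (1 : ℝ) < 3 / 2))
    simpa using this
  refine Summable.of_nonneg_of_le (doubleZetaTerm_nonneg a b) (fun p => ?_)
    (hs.mul_of_nonneg hs (fun _ => by positivity) (fun _ => by positivity))
  obtain ⟨i, j⟩ := p
  have hx : (1 : ℝ) ≤ (i : ℝ) + 1 := by linarith [Nat.cast_nonneg (α := ℝ) i]
  have hy : (1 : ℝ) ≤ (j : ℝ) + 1 := by linarith [Nat.cast_nonneg (α := ℝ) j]
  unfold doubleZetaTerm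
  simp only
  rw [show (i : ℝ) + j + 2 = (i + 1) + (j + 1) by ring, one_div_mul_one_div_rev]
  generalize (i : ℝ) + 1 = x at *
  generalize (j : ℝ) + 1 = y at *
  have hx0 : 0 < x := by linarith
  have hy0 : 0 < y := by linarith
  refine one_div_le_one_div_of_le (by positivity) ?_
  calc y ^ (3 / 2 : ℝ) * x ^ (3 / 2 : ℝ)
      = y ^ (3 / 2 : ℝ) * x ^ (1 / 2 : ℝ) * x := by
        rw [mul_assoc, ← Real.rpow_add_one hx0.ne']; norm_num
    _ ≤ (x + y) ^ (3 / 2 : ℝ) * (x + y) ^ (1 / 2 : ℝ) * x := by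
        gcongr <;> linarith
    _ = (x + y) ^ 2 * x ^ 1 := by
        rw [← Real.rpow_add (by positivity)]; norm_num
    _ ≤ (x + y) ^ a * x ^ b := by
        gcongr
        linarith

lemma hasSum_mzv_pair {a b : ℕ} (ha : 2 ≤ a) (hb : 1 ≤ b) :
    HasSum (doubleZetaTerm a b) (mzv [a, b]) := by
  rw [mzv_pair]
  exact (summable_doubleZetaTerm ha hb).hasSum

/-- The stuffle product of two zeta values. -/
lemma mzv_mul_mzv {a b : ℕ} (ha : 2 ≤ a) (hb : 2 ≤ b) :
    mzv [a] * mzv [b] = mzv [a, b] + mzv [b, a] + mzv [a + b] := by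
  set f : ℕ × ℕ → ℝ := fun p => 1 / ((p.1 : ℝ) + 1) ^ a * (1 / ((p.2 : ℝ) + 1) ^ b) with hf
  have hprod : HasSum f (mzv [a] * mzv [b]) :=
    (hasSum_mzv_singleton ha).mul (hasSum_mzv_singleton hb)
      ((hasSum_mzv_singleton ha).summable.mul_of_nonneg (hasSum_mzv_singleton hb).summable
        (fun _ => by positivity) (fun _ => by positivity))
  have hgt : HasSum (fun p : ℕ × ℕ => if p.2 < p.1 then f p else 0) (mzv [a, b]) := by
    have hinj : Function.Injective fun p : ℕ × ℕ => (p.1 + p.2 + 1, p.1) := by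
      rintro ⟨i, j⟩ ⟨i', j'⟩ h
      simp only [Prod.mk.injEq] at h ⊢
      omega
    rw [← hinj.hasSum_iff]
    · convert hasSum_mzv_pair ha (by omega : 1 ≤ b) using 1
      funext p
      simp only [Function.comp, hf, doubleZetaTerm]
      rw [if_pos (by omega), one_div_mul_one_div_rev, mul_comm]
      push_cast
      ring_nf
    · rintro ⟨i, j⟩ h
      refine if_neg fun (hij : j < i) => h ⟨(j, i - j - 1), ?_⟩
      simp only [Prod.mk.injEq, and_true]
      omega
  have hlt : HasSum (fun p : ℕ × ℕ => if p.1 < p.2 then f p else 0) (mzv [b, a]) := by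
    have hinj : Function.Injective fun p : ℕ × ℕ => (p.1, p.1 + p.2 + 1) := by
      rintro ⟨i, j⟩ ⟨i', j'⟩ h
      simp only [Prod.mk.injEq] at h ⊢
      omega
    rw [← hinj.hasSum_iff]
    · convert hasSum_mzv_pair hb (by omega : 1 ≤ a) using 1
      funext p
      simp only [Function.comp, hf, doubleZetaTerm]
      rw [if_pos (by omega), one_div_mul_one_div_rev]
      push_cast
      ring_nf
    · rintro ⟨i, j⟩ h
      refine if_neg fun (hij : i < j) => h ⟨(i, j - i - 1), ?_⟩
      simp only [Prod.mk.injEq, true_and]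
      omega
  have heq : HasSum (fun p : ℕ × ℕ => if p.1 = p.2 then f p else 0) (mzv [a + b]) := by
    have hinj : Function.Injective fun n : ℕ => (n, n) := fun _ _ h => (Prod.mk.inj h).1
    rw [← hinj.hasSum_iff]
    · convert hasSum_mzv_singleton (by omega : 2 ≤ a + b) using 1
      funext n
      simp only [Function.comp, hf, if_true]
      rw [one_div_mul_one_div_rev, pow_add, mul_comm]
    · rintro ⟨i, j⟩ h
      refine if_neg fun (hij : i = j) => h ⟨i, ?_⟩
      simp only [hij]
  refine hprod.unique ?_
  convert (hgt.add hlt).add heq using 1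
  funext p
  rcases lt_trichotomy p.1 p.2 with h | h | h
  · rw [if_neg h.not_gt, if_pos h, if_neg h.ne]; ring
  · rw [if_neg h.not_gt, if_neg h.not_lt, if_pos h]; ring
  · rw [if_pos h, if_neg h.not_gt, if_neg h.ne']; ring

lemma one_div_pow_mul_add_mul (n : ℕ) {x y : ℝ} (hx : 0 < x) (hy : 0 < y) :
    1 / (x ^ (n + 1) * ((x + y) * y)) =
      1 / ((x + y) ^ (n + 2) * y) +
        ∑ k ∈ Finset.range (n + 1), 1 / ((x + y) ^ (k + 2) * x ^ (n + 1 - k)) := by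
  induction n with
  | zero =>
    simp
    field_simp
  | succ n ih =>
    rw [Finset.sum_range_succ]
    have hsum : ∑ k ∈ Finset.range (n + 1), 1 / ((x + y) ^ (k + 2) * x ^ (n + 1 + 1 - k)) =
        (∑ k ∈ Finset.range (n + 1), 1 / ((x + y) ^ (k + 2) * x ^ (n + 1 - k))) / x := by
      rw [Finset.sum_div]
      refine Finset.sum_congr rfl fun k hk => ?_
      rw [Finset.mem_range] at hk
      rw [show n + 1 + 1 - k = (n + 1 - k) + 1 by omega, pow_succ x, div_div, mul_assoc]
    have hL : 1 / (x ^ (n + 1 + 1) * ((x + y) * y)) = 1 / (x ^ (n + 1) * ((x + y) * y)) / x := by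
      rw [div_div, pow_succ]
      ring_nf
    rw [hL, ih, hsum, show n + 1 + 1 - (n + 1) = 1 by omega]
    field_simp
    ring

/-- `∑_{y ≥ 1} (1/y - 1/(x+y))` is the harmonic number of index `x`. -/
lemma hasSum_one_div_sub_one_div (x : ℕ) :
    HasSum (fun y : ℕ => 1 / ((y : ℝ) + 1) - 1 / ((x : ℝ) + y + 1))
      (∑ i ∈ Finset.range x, 1 / ((i : ℝ) + 1)) := by
  induction x with
  | zero => simp
  | succ x ih =>
    have h : HasSum (fun y : ℕ => 1 / ((x : ℝ) + y + 1) - 1 / ((x : ℝ) + y + 2))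
        (1 / ((x : ℝ) + 1)) := by
      rw [hasSum_iff_tendsto_nat_of_nonneg]
      · have hs : ∀ n : ℕ, ∑ i ∈ Finset.range n,
            (1 / ((x : ℝ) + i + 1) - 1 / ((x : ℝ) + i + 2)) =
            1 / ((x : ℝ) + 1) - 1 / ((n : ℝ) + (x + 1)) := by
          intro n
          induction n with
          | zero => simp
          | succ n ihn =>
            rw [Finset.sum_range_succ, ihn]
            push_cast
            ring_nf
        simp_rw [hs]
        have ht : Tendsto (fun n : ℕ => 1 / ((n : ℝ) + (x + 1))) atTop (𝓝 0) := by
          simp_rw [one_div]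
          exact tendsto_inv_atTop_zero.comp
            (tendsto_atTop_add_const_right _ _ tendsto_natCast_atTop_atTop)
        simpa using tendsto_const_nhds.sub ht
      · intro i
        rw [sub_nonneg]
        exact one_div_le_one_div_of_le (by positivity) (by linarith)
    rw [Finset.sum_range_succ]
    convert ih.add h using 1
    funext y
    push_cast
    ring_nf

lemma hasSum_harmonic_div_pow (n : ℕ) :
    HasSum (fun N : ℕ => (∑ i ∈ Finset.range (N + 1), 1 / ((i : ℝ) + 1)) / ((N : ℝ) + 1) ^ (n + 2))
      (mzv [n + 2, 1] + mzv [n + 3]) := by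
  have h1 : HasSum (fun N : ℕ => (∑ i ∈ Finset.range (N + 1), 1 / ((i : ℝ) + 1)) /
      ((N : ℝ) + 2) ^ (n + 2)) (mzv [n + 2, 1]) := by
    have h := hasSum_mzv_pair (a := n + 2) (b := 1) (by omega) le_rfl
    rw [← Finset.HasAntidiagonal.sigmaAntidiagonalEquivProd.hasSum_iff] at h
    refine h.sigma fun N => ?_
    convert hasSum_fintype _ using 1
    change _ = ∑ p ∈ (Finset.HasAntidiagonal.antidiagonal N).attach, doubleZetaTerm (n + 2) 1 p.1
    rw [Finset.sum_attach (Finset.HasAntidiagonal.antidiagonal N) (doubleZetaTerm (n + 2) 1),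
      Finset.Nat.sum_antidiagonal_eq_sum_range_succ_mk, Finset.sum_div]
    refine Finset.sum_congr rfl fun i hi => ?_
    have hi' : i ≤ N := by
      rw [Finset.mem_range] at hi
      omega
    simp only [doubleZetaTerm]
    rw [Nat.cast_sub hi', div_div, pow_one, mul_comm]
    ring_nf
  have h2 := hasSum_mzv_singleton (by omega : 2 ≤ n + 3)
  rw [← hasSum_nat_add_iff' 1] at h2 ⊢
  convert! h1.add h2 using 1
  · funext N
    rw [Finset.sum_range_succ]
    push_cast
    rw [show (N : ℝ) + 1 + 1 = N + 2 by ring, pow_succ _ (n + 2)]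
    field_simp
  · simp
    ring

/-- The sum formula for double zeta values. -/
lemma sum_mzv_pair (n : ℕ) :
    ∑ k ∈ Finset.range (n + 1), mzv [k + 2, n + 1 - k] = mzv [n + 3] := by
  have hswap : HasSum (fun p : ℕ × ℕ => doubleZetaTerm (n + 2) 1 p.swap) (mzv [n + 2, 1]) :=
    (Equiv.prodComm ℕ ℕ).hasSum_iff.2 (hasSum_mzv_pair (by omega) le_rfl)
  have hsum : HasSum (fun p => ∑ k ∈ Finset.range (n + 1), doubleZetaTerm (k + 2) (n + 1 - k) p)
      (∑ k ∈ Finset.range (n + 1), mzv [k + 2, n + 1 - k]) := by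
    refine hasSum_sum fun k hk => hasSum_mzv_pair (by omega) ?_
    rw [Finset.mem_range] at hk
    omega
  have h := (hswap.add hsum).prod_fiberwise
    (g := fun x : ℕ => (∑ i ∈ Finset.range (x + 1), 1 / ((i : ℝ) + 1)) / ((x : ℝ) + 1) ^ (n + 2))
    (fun x => by
      have hx := (hasSum_one_div_sub_one_div (x + 1)).div_const (((x : ℝ) + 1) ^ (n + 2))
      convert! hx using 1
      funext y
      have key := one_div_pow_mul_add_mul n (x := (x : ℝ) + 1) (y := (y : ℝ) + 1)
        (by positivity) (by positivity)
      simp only [doubleZetaTerm, Prod.fst_swap, Prod.snd_swap, pow_one]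
      rw [show (x : ℝ) + 1 + (y + 1) = x + y + 2 by ring] at key
      rw [show (y : ℝ) + x + 2 = x + y + 2 by ring, ← key]
      push_cast
      rw [show (x : ℝ) + 1 + y + 1 = x + y + 2 by ring]
      field_simp
      ring)
  linarith [h.unique (hasSum_harmonic_div_pow n)]

/-- Euler's evaluation of `ζ(n + 2, 1)`. -/
lemma two_mul_mzv_pair_one (n : ℕ) :
    2 * mzv [n + 2, 1] =
      ((n : ℝ) + 2) * mzv [n + 3] -
        ∑ k ∈ Finset.range n, mzv [k + 2] * mzv [n + 1 - k] := by
  have h1 := sum_mzv_pair n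
  rw [Finset.sum_range_succ, show n + 1 - n = 1 by omega] at h1
  have h2 : ∑ k ∈ Finset.range n, mzv [n + 1 - k, k + 2] =
      ∑ k ∈ Finset.range n, mzv [k + 2, n + 1 - k] := by
    rw [← Finset.sum_range_reflect]
    refine Finset.sum_congr rfl fun k hk => ?_
    rw [Finset.mem_range] at hk
    rw [show n + 1 - (n - 1 - k) = k + 2 by omega, show n - 1 - k + 2 = n + 1 - k by omega]
  have h3 : ∑ k ∈ Finset.range n, mzv [k + 2] * mzv [n + 1 - k] =
      ∑ k ∈ Finset.range n, (mzv [k + 2, n + 1 - k] + mzv [n + 1 - k, k + 2] + mzv [n + 3]) := by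
    refine Finset.sum_congr rfl fun k hk => ?_
    rw [Finset.mem_range] at hk
    rw [mzv_mul_mzv (by omega) (by omega), show k + 2 + (n + 1 - k) = n + 3 by omega]
  rw [Finset.sum_add_distrib, Finset.sum_add_distrib, h2, Finset.sum_const, Finset.card_range,
    nsmul_eq_mul] at h3
  linarith

lemma sum_range_two_mul {M : Type*} [AddCommMonoid M] (n : ℕ) (g : ℕ → M) :
    ∑ k ∈ Finset.range (2 * n), g k =
      ∑ k ∈ Finset.range n, g (2 * k) + ∑ k ∈ Finset.range n, g (2 * k + 1) := by
  induction n with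
  | zero => simp
  | succ n ih =>
    rw [show 2 * (n + 1) = 2 * n + 1 + 1 by ring]
    simp only [Finset.sum_range_succ, ih]
    abel

section BernoulliConvolution

open PowerSeries

/-- Euler's quadratic relation between Bernoulli numbers, as a differential equation for
`X / (exp X - 1)`. -/
lemma bernoulliPowerSeries_sq :
    bernoulliPowerSeries ℚ ^ 2 + X * bernoulliPowerSeries ℚ +
      X * derivative ℚ (bernoulliPowerSeries ℚ) = bernoulliPowerSeries ℚ := by
  have h := bernoulliPowerSeries_mul_exp_sub_one ℚ
  set f := bernoulliPowerSeries ℚ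
  have hd : derivative ℚ (exp ℚ) = exp ℚ := by
    ext n
    rw [coeff_derivative, coeff_exp, coeff_exp]
    simp [Nat.factorial_succ]
    field_simp
  have h' := congrArg (derivative ℚ) h
  rw [Derivation.leibniz, map_sub, hd, derivative_one, derivative_X, sub_zero, smul_eq_mul,
    smul_eq_mul] at h'
  have hX : (X : PowerSeries ℚ) ≠ 0 := X_ne_zero
  have hE : exp ℚ - 1 ≠ 0 := fun h0 => hX (by rw [← h, h0, mul_zero])
  refine mul_right_cancel₀ hE ?_
  linear_combination (f - 1) * h + X * h'

end BernoulliConvolution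

lemma sum_range_bernoulli_mul (n : ℕ) :
    ∑ l ∈ Finset.range (n + 1),
      (bernoulli (2 * (l + 1)) / (2 * (l + 1)).factorial) *
        (bernoulli (2 * (n + 1 - l)) / (2 * (n + 1 - l)).factorial) =
      -(2 * n + 5) * (bernoulli (2 * (n + 2)) / (2 * (n + 2)).factorial) := by
  set b : ℕ → ℚ := fun k => bernoulli k / k.factorial with hb
  have hodd : ∀ k, b (2 * k + 3) = 0 := fun k => by
    simp only [hb]
    rw [bernoulli_eq_zero_of_odd ⟨k + 1, by ring⟩ (by omega), zero_div]
  have h := congrArg (PowerSeries.coeff (2 * n + 4)) bernoulliPowerSeries_sq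
  have hc : ∀ k, PowerSeries.coeff k (bernoulliPowerSeries ℚ) = b k := fun k => by
    simp [bernoulliPowerSeries, hb]
  rw [map_add, map_add, PowerSeries.coeff_succ_X_mul, PowerSeries.coeff_succ_X_mul,
    PowerSeries.coeff_derivative, pow_two, PowerSeries.coeff_mul,
    Finset.Nat.sum_antidiagonal_eq_sum_range_succ_mk] at h
  simp only [hc] at h
  rw [Nat.succ_eq_add_one, show 2 * n + 4 + 1 = 2 * (n + 2) + 1 by ring,
    Finset.sum_range_succ, sum_range_two_mul,
    Finset.sum_eq_zero (s := Finset.range (n + 2)) (f := fun k => b (2 * k + 1) * _), hodd,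
    Finset.sum_range_succ'] at h
  · have hb0 : b 0 = 1 := by simp [hb]
    have h0 : 2 * n + 4 - 2 * (n + 2) = 0 := by omega
    rw [h0, mul_zero, hb0, Nat.sub_zero, show 2 * n + 3 + 1 = 2 * (n + 2) by ring] at h
    have hs : ∑ l ∈ Finset.range (n + 1), b (2 * (l + 1)) * b (2 * (n + 2) - 2 * (l + 1)) =
        ∑ l ∈ Finset.range (n + 1), b (2 * (l + 1)) * b (2 * (n + 1 - l)) := by
      refine Finset.sum_congr rfl fun l _ => ?_
      rw [show 2 * (n + 2) - 2 * (l + 1) = 2 * (n + 1 - l) by omega]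
    rw [hs] at h
    push_cast at h
    linear_combination h
  · intro k hk
    rw [Finset.mem_range] at hk
    rcases Nat.eq_zero_or_pos k with rfl | hk0
    · rw [show 2 * n + 4 - (2 * 0 + 1) = 2 * n + 3 by omega, hodd, mul_zero]
    · rw [show 2 * k + 1 = 2 * (k - 1) + 3 by omega, hodd, zero_mul]

lemma mzv_even {k : ℕ} (hk : k ≠ 0) :
    mzv [2 * k] = (-1 : ℝ) ^ (k + 1) * 2 ^ (2 * k - 1) * Real.pi ^ (2 * k) *
      ((bernoulli (2 * k) / (2 * k).factorial : ℚ) : ℝ) := by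
  have h := hasSum_zeta_nat hk
  rw [← hasSum_nat_add_iff' 1] at h
  have h2 := (hasSum_mzv_singleton (by omega : 2 ≤ 2 * k)).unique (by simpa [hk] using h)
  rw [h2]
  push_cast
  ring

lemma mzv_two : mzv [2] = Real.pi ^ 2 / 6 := by
  have h := mzv_even one_ne_zero
  rw [mul_one] at h
  rw [h, bernoulli_two]
  norm_num [Nat.factorial]
  ring

/-- The convolution of even zeta values, including the degenerate weight `2`. -/
lemma sum_range_mzv_even_mul (n : ℕ) :
    ∑ l ∈ Finset.range n, mzv [2 * (l + 1)] * mzv [2 * (n - l)] =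
      ((n : ℝ) + 3 / 2) * mzv [2 * (n + 1)] - if n = 0 then Real.pi ^ 2 / 4 else 0 := by
  rcases n with _ | n
  · simp [mzv_two]
    ring
  · have hB := congrArg (fun q : ℚ => (q : ℝ)) (sum_range_bernoulli_mul n)
    simp only [Rat.cast_sum, Rat.cast_mul] at hB
    rw [if_neg (Nat.succ_ne_zero n), mzv_even (by omega : n + 1 + 1 ≠ 0)]
    have hs : ∑ l ∈ Finset.range (n + 1), mzv [2 * (l + 1)] * mzv [2 * (n + 1 - l)] =
        (-1 : ℝ) ^ n * 2 ^ (2 * n + 2) * Real.pi ^ (2 * n + 4) *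
        ∑ l ∈ Finset.range (n + 1),
          ((bernoulli (2 * (l + 1)) / (2 * (l + 1)).factorial : ℚ) : ℝ) *
          ((bernoulli (2 * (n + 1 - l)) / (2 * (n + 1 - l)).factorial : ℚ) : ℝ) := by
      rw [Finset.mul_sum]
      refine Finset.sum_congr rfl fun l hl => ?_
      rw [Finset.mem_range] at hl
      rw [mzv_even (by omega), mzv_even (by omega)]
      obtain ⟨c, rfl⟩ : ∃ c, n = l + c := ⟨n - l, by omega⟩
      rw [show l + c + 1 - l = c + 1 by omega, show 2 * (l + 1) - 1 = 2 * l + 1 by omega,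
        show 2 * (c + 1) - 1 = 2 * c + 1 by omega]
      ring
    rw [hs, hB, show 2 * (n + 1 + 1) - 1 = 2 * n + 3 by omega,
      show n + 1 + 1 = n + 2 by ring]
    push_cast
    ring

lemma sum_filter_add_two_mul_eq (r : ℕ) (g : ℕ → ℕ → ℝ) :
    ∑ p ∈ (Finset.range (2 * r + 1 + 1) ×ˢ Finset.range (2 * r + 1 + 1)).filter
        (fun p => 1 ≤ p.1 ∧ 1 ≤ p.2 ∧ p.1 + 2 * p.2 = 2 * r + 1), g p.1 p.2 =
      ∑ n ∈ Finset.range r, g (2 * (r - n) - 1) (n + 1) := by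
  refine Finset.sum_nbij' (fun p => p.2 - 1) (fun n => (2 * (r - n) - 1, n + 1)) ?_ ?_ ?_ ?_ ?_
  · rintro ⟨i, k⟩ h
    simp only [Finset.mem_filter, Finset.mem_product, Finset.mem_range] at h ⊢
    omega
  · intro n h
    simp only [Finset.mem_filter, Finset.mem_product, Finset.mem_range] at h ⊢
    omega
  · rintro ⟨i, k⟩ h
    simp only [Finset.mem_filter, Finset.mem_product, Finset.mem_range, Prod.mk.injEq] at h ⊢
    omega
  · intro n h
    simp
  · rintro ⟨i, k⟩ h
    simp only [Finset.mem_filter, Finset.mem_product, Finset.mem_range] at h ⊢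
    congr 1 <;> omega

/-- Exactly one of `i`, `j` is even when `i + j + 2k` is odd. -/
lemma sum_filter_add_add_two_mul_eq (r : ℕ) (g : ℕ → ℕ → ℕ → ℝ) (hg : ∀ i j k, g i j k = g j i k) :
    ∑ t ∈ ((Finset.range (2 * r + 1 + 1) ×ˢ Finset.range (2 * r + 1 + 1)) ×ˢ
          Finset.range (2 * r + 1 + 1)).filter
        (fun t => 1 ≤ t.1.1 ∧ 1 ≤ t.1.2 ∧ 1 ≤ t.2 ∧ t.1.1 + t.1.2 + 2 * t.2 = 2 * r + 1),
        g t.1.1 t.1.2 t.2 =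
      2 * ∑ n ∈ Finset.range r, ∑ l ∈ Finset.range n, g (2 * (r - n)) (2 * l + 1) (n - l) := by
  rw [← Finset.sum_filter_add_sum_filter_not _ (fun t => Even t.1.1),
    two_mul (Finset.sum _ _)]
  congr 1
  · rw [Finset.sum_sigma']
    refine Finset.sum_nbij' (fun t => (⟨t.2 + t.1.2 / 2, t.1.2 / 2⟩ : Σ _ : ℕ, ℕ))
      (fun s : (Σ _ : ℕ, ℕ) => ((2 * (r - s.1), 2 * s.2 + 1), s.1 - s.2)) ?_ ?_ ?_ ?_ ?_
    · rintro ⟨⟨i, j⟩, k⟩ h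
      simp only [Finset.mem_filter, Finset.mem_product, Finset.mem_range, Finset.mem_sigma,
        Nat.even_iff] at h ⊢
      omega
    · rintro ⟨n, l⟩ h
      simp only [Finset.mem_filter, Finset.mem_product, Finset.mem_range, Finset.mem_sigma,
        Nat.even_iff] at h ⊢
      omega
    · rintro ⟨⟨i, j⟩, k⟩ h
      simp only [Finset.mem_filter, Finset.mem_product, Finset.mem_range, Prod.mk.injEq,
        Nat.even_iff] at h ⊢
      omega
    · rintro ⟨n, l⟩ h
      simp only [Finset.mem_range, Finset.mem_sigma] at h
      have h1 : (2 * l + 1) / 2 = l := by omega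
      simp only [h1, Nat.sub_add_cancel h.2.le]
    · rintro ⟨⟨i, j⟩, k⟩ h
      simp only [Finset.mem_filter, Finset.mem_product, Finset.mem_range, Nat.even_iff] at h ⊢
      congr 1 <;> omega
  · rw [Finset.sum_sigma']
    refine Finset.sum_nbij' (fun t => (⟨t.2 + t.1.1 / 2, t.1.1 / 2⟩ : Σ _ : ℕ, ℕ))
      (fun s : (Σ _ : ℕ, ℕ) => ((2 * s.2 + 1, 2 * (r - s.1)), s.1 - s.2)) ?_ ?_ ?_ ?_ ?_
    · rintro ⟨⟨i, j⟩, k⟩ h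
      simp only [Finset.mem_filter, Finset.mem_product, Finset.mem_range, Finset.mem_sigma,
        Nat.even_iff] at h ⊢
      omega
    · rintro ⟨n, l⟩ h
      simp only [Finset.mem_filter, Finset.mem_product, Finset.mem_range, Finset.mem_sigma,
        Nat.even_iff] at h ⊢
      omega
    · rintro ⟨⟨i, j⟩, k⟩ h
      simp only [Finset.mem_filter, Finset.mem_product, Finset.mem_range, Prod.mk.injEq,
        Nat.even_iff] at h ⊢
      omega
    · rintro ⟨n, l⟩ h
      simp only [Finset.mem_range, Finset.mem_sigma] at h
      have h1 : (2 * l + 1) / 2 = l := by omega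
      simp only [h1, Nat.sub_add_cancel h.2.le]
    · rintro ⟨⟨i, j⟩, k⟩ h
      simp only [Finset.mem_filter, Finset.mem_product, Finset.mem_range, Nat.even_iff] at h ⊢
      rw [hg]
      congr 1 <;> omega

lemma sum_range_mzv_mul_mzv_eq (r : ℕ) :
    ∑ k ∈ Finset.range (2 * r), mzv [k + 2] * mzv [2 * r + 1 - k] =
      2 * ∑ n ∈ Finset.range r, mzv [2 * (r - n) + 1] * mzv [2 * (n + 1)] := by
  rw [sum_range_two_mul, two_mul (Finset.sum _ _)]
  congr 1
  · refine Finset.sum_congr rfl fun n hn => ?_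
    rw [Finset.mem_range] at hn
    rw [mul_comm, show 2 * r + 1 - 2 * n = 2 * (r - n) + 1 by omega,
      show 2 * n + 2 = 2 * (n + 1) by ring]
  · rw [← Finset.sum_range_reflect]
    refine Finset.sum_congr rfl fun n hn => ?_
    rw [Finset.mem_range] at hn
    rw [show 2 * (r - 1 - n) + 1 + 2 = 2 * (r - n) + 1 by omega,
      show 2 * r + 1 - (2 * (r - 1 - n) + 1) = 2 * (n + 1) by omega]

/-- For odd `m ≥ 3`:
`(m+2)·ζ(m+1,1) = −(π²/2)ζ(m) + ((m+1)(m+2)/2)ζ(m+2) − ∑_{i+2k=m}(i+1)ζ(i+2)ζ(2k)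
  − ∑_{i+j+2k=m} ζ(i+1)ζ(j+1)ζ(2k)`. -/
theorem double_zeta_relation_odd (m : ℕ) (hm : 3 ≤ m) (hodd : Odd m) :
    ((m : ℝ) + 2) * mzv [m + 1, 1] =
      -(Real.pi ^ 2 / 2) * mzv [m] + ((m : ℝ) + 1) * ((m : ℝ) + 2) / 2 * mzv [m + 2] -
        (∑ p ∈ (Finset.range (m + 1) ×ˢ Finset.range (m + 1)).filter
            (fun p => 1 ≤ p.1 ∧ 1 ≤ p.2 ∧ p.1 + 2 * p.2 = m),
          ((p.1 : ℝ) + 1) * mzv [p.1 + 2] * mzv [2 * p.2]) -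
        ∑ t ∈ ((Finset.range (m + 1) ×ˢ Finset.range (m + 1)) ×ˢ Finset.range (m + 1)).filter
            (fun t => 1 ≤ t.1.1 ∧ 1 ≤ t.1.2 ∧ 1 ≤ t.2 ∧ t.1.1 + t.1.2 + 2 * t.2 = m),
          mzv [t.1.1 + 1] * mzv [t.1.2 + 1] * mzv [2 * t.2] := by
  obtain ⟨r, rfl⟩ := hodd
  have hr : 0 < r := by omega
  have hE := two_mul_mzv_pair_one (2 * r)
  rw [sum_range_mzv_mul_mzv_eq] at hE
  rw [sum_filter_add_two_mul_eq r (fun i k => ((i : ℝ) + 1) * mzv [i + 2] * mzv [2 * k]),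
    sum_filter_add_add_two_mul_eq r (fun i j k => mzv [i + 1] * mzv [j + 1] * mzv [2 * k])
      (fun i j k => by ring)]
  have hD : ∑ n ∈ Finset.range r, (((2 * (r - n) - 1 : ℕ) : ℝ) + 1) *
      mzv [2 * (r - n) - 1 + 2] * mzv [2 * (n + 1)] =
      ∑ n ∈ Finset.range r,
        (2 * (r : ℝ) - 2 * n) * (mzv [2 * (r - n) + 1] * mzv [2 * (n + 1)]) := by
    refine Finset.sum_congr rfl fun n hn => ?_
    rw [Finset.mem_range] at hn
    obtain ⟨c, rfl⟩ : ∃ c, r = n + c + 1 := ⟨r - n - 1, by omega⟩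
    rw [show 2 * (n + c + 1 - n) - 1 = 2 * c + 1 by omega,
      show 2 * (n + c + 1 - n) + 1 = 2 * c + 1 + 2 by omega]
    push_cast
    ring
  have hT : ∑ n ∈ Finset.range r, ∑ l ∈ Finset.range n,
      mzv [2 * (r - n) + 1] * mzv [2 * l + 1 + 1] * mzv [2 * (n - l)] =
      ∑ n ∈ Finset.range r,
        ((n : ℝ) + 3 / 2) * (mzv [2 * (r - n) + 1] * mzv [2 * (n + 1)]) -
        Real.pi ^ 2 / 4 * mzv [2 * r + 1] := by
    have hn : ∀ n ∈ Finset.range r, ∑ l ∈ Finset.range n,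
        mzv [2 * (r - n) + 1] * mzv [2 * l + 1 + 1] * mzv [2 * (n - l)] =
        ((n : ℝ) + 3 / 2) * (mzv [2 * (r - n) + 1] * mzv [2 * (n + 1)]) -
          if n = 0 then Real.pi ^ 2 / 4 * mzv [2 * r + 1] else 0 := by
      intro n _
      simp_rw [mul_assoc]
      rw [← Finset.mul_sum]
      change _ * ∑ l ∈ Finset.range n, mzv [2 * (l + 1)] * mzv [2 * (n - l)] = _
      rw [sum_range_mzv_even_mul]
      rcases n with _ | n
      · simp only [if_true, Nat.sub_zero]
        ring
      · simp only [Nat.succ_ne_zero, if_false]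
        ring
    rw [Finset.sum_congr rfl hn, Finset.sum_sub_distrib, Finset.sum_ite_eq',
      if_pos (Finset.mem_range.2 hr)]
  have hcomb : ∑ n ∈ Finset.range r,
        (2 * (r : ℝ) - 2 * n) * (mzv [2 * (r - n) + 1] * mzv [2 * (n + 1)]) +
      2 * ∑ n ∈ Finset.range r,
        ((n : ℝ) + 3 / 2) * (mzv [2 * (r - n) + 1] * mzv [2 * (n + 1)]) =
      (2 * (r : ℝ) + 3) *
        ∑ n ∈ Finset.range r, mzv [2 * (r - n) + 1] * mzv [2 * (n + 1)] := by
    rw [Finset.mul_sum, Finset.mul_sum, ← Finset.sum_add_distrib]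
    refine Finset.sum_congr rfl fun n _ => ?_
    ring
  rw [hD, hT]
  push_cast at hE ⊢
  change (2 * (r : ℝ) + 1 + 2) * mzv [2 * r + 2, 1] =
    _ + (2 * (r : ℝ) + 1 + 1) * (2 * r + 1 + 2) / 2 * mzv [2 * r + 3] - _ - _
  linear_combination (2 * (r : ℝ) + 3) / 2 * hE + hcomb
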